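/- arXiv:1610.03991 — 4 statements merged into one kernel-verified Lean document; each statement's English description precedes it below -/
import Mathlib

section
/- Let M be an n×n real symmetric positive definite matrix, let K be an n×n real symmetric positive semidefinite matrix, and let α > 0. Then the 2n×2n block matrix X = [[M, -αK], [K, M]] is invertible. -/
open Matrix

/-- A block matrix with positive definite diagonal blocks `M`, `N` and off-diagonal
blocks `-(α • K)`, `K`, where `K` is symmetric and `α > 0`, is invertible. -/
theorem Matrix.PosDef.isUnit_fromBlocks_neg_smul {ι : Type*} [Fintype ι] [DecidableEq ι]
    {M N K : Matrix ι ι ℝ} (hM : M.PosDef) (hN : N.PosDef) (hK : K.IsSymm)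
    {α : ℝ} (hα : 0 < α) :
    IsUnit (Matrix.fromBlocks M (-(α • K)) K N) := by
  rw [← mulVec_injective_iff_isUnit, ← coe_mulVecLin, ← LinearMap.ker_eq_bot,
    LinearMap.ker_eq_bot']
  intro w hw
  obtain ⟨u, v, rfl⟩ : ∃ u v, w = Sum.elim u v := ⟨_, _, (Sum.elim_comp_inl_inr w).symm⟩
  rw [mulVecLin_apply, fromBlocks_mulVec, ← Sum.elim_zero_zero, Sum.elim_eq_iff] at hw
  simp only [Sum.elim_comp_inl, Sum.elim_comp_inr, neg_mulVec, smul_mulVec] at hw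
  obtain ⟨h₁, h₂⟩ := hw
  have hu := congrArg (u ⬝ᵥ ·) h₁
  have hv := congrArg (v ⬝ᵥ ·) h₂
  simp only [dotProduct_add, dotProduct_neg, dotProduct_smul, dotProduct_zero, smul_eq_mul]
    at hu hv
  have hsymm : v ⬝ᵥ K *ᵥ u = u ⬝ᵥ K *ᵥ v := by
    rw [dotProduct_mulVec, ← mulVec_transpose, hK.eq, dotProduct_comm]
  have hsum : u ⬝ᵥ M *ᵥ u + α * (v ⬝ᵥ N *ᵥ v) = 0 := by
    rw [hsymm] at hv
    linear_combination hu + α * hv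
  have hMu : 0 ≤ u ⬝ᵥ M *ᵥ u := hM.posSemidef.dotProduct_mulVec_nonneg u
  have hNv : 0 ≤ v ⬝ᵥ N *ᵥ v := hN.posSemidef.dotProduct_mulVec_nonneg v
  have hu0 : u = 0 := by
    by_contra h
    have : 0 < u ⬝ᵥ M *ᵥ u := hM.dotProduct_mulVec_pos h
    linarith [mul_nonneg hα.le hNv]
  have hv0 : v = 0 := by
    by_contra h
    have : 0 < v ⬝ᵥ N *ᵥ v := hN.dotProduct_mulVec_pos h
    linarith [mul_pos hα this]
  rw [hu0, hv0, Sum.elim_zero_zero]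

theorem blockMatrix_X_isUnit
    {n : ℕ} (M K : Matrix (Fin n) (Fin n) ℝ)
    (hM : M.PosDef) (hK : K.PosSemidef) (α : ℝ) (hα : 0 < α) :
    IsUnit (Matrix.fromBlocks M (-(α • K)) K M) :=
  hM.isUnit_fromBlocks_neg_smul hM (by simpa [IsHermitian, IsSymm] using hK.isHermitian) hα
end

section
/- Let M be an n×n real symmetric positive definite matrix, K an n×n real symmetrical positive semidefinite matrix, α > 0, and set C = K M⁻¹. Then the matrix W = I + α C² is invertible. -/
open Matrix

theorem W_isUnit
    {n : ℕ} (M K : Matrix (Fin n) (Fin n) ℝ)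
    (hM : M.PosDef) (hK : K.PosSemidef) (α : ℝ) (hα : 0 < α) :
    IsUnit ((1 : Matrix (Fin n) (Fin n) ℝ) + α • (K * M⁻¹ * (K * M⁻¹))) := by
  have hKMK : (K * M⁻¹ * K).PosSemidef := by
    simpa only [hK.isHermitian.eq] using hM.inv.posSemidef.conjTranspose_mul_mul_same K
  have hWM : (1 + α • (K * M⁻¹ * (K * M⁻¹))) * M = M + α • (K * M⁻¹ * K) := by
    have hinv : M⁻¹ * M = 1 := nonsing_inv_mul M ((isUnit_iff_isUnit_det M).mp hM.isUnit)
    simp only [add_mul, one_mul, smul_mul_assoc, mul_assoc, hinv, mul_one]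
  have hunit := (hM.add_posSemidef (hKMK.smul hα.le)).isUnit
  rw [← hWM] at hunit
  exact hM.isUnit.mul_right_iff.mp hunit
end

section
/- Let M be an n×n real symmetric positive definite matrix, K and Λ n×n real symmetric positive semidefinite matrices, and α, β > 0. Set C = K M⁻¹, W = I + αC², X = [[M, -αK], [K, M]], and Y = [[M, -αK - βΛ], [K, M]]. Then X⁻¹(X - Y) = β · [[0, (WM)⁻¹Λ], [0, -(WM)⁻¹CΛ]]. -/
open Matrix

/-- The matrix `M + α K M⁻¹ K`, up to sign the Schur complement of `M` in `[[M, -αK], [K, M]]`,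
is positive definite. -/
theorem posDef_add_smul_mul_inv_mul {ι : Type*} [Fintype ι] [DecidableEq ι]
    {M K : Matrix ι ι ℝ} (hM : M.PosDef) (hK : K.IsHermitian) {α : ℝ} (hα : 0 ≤ α) :
    (M + α • (K * M⁻¹ * K)).PosDef := by
  have h := hM.inv.posSemidef.conjTranspose_mul_mul_same K
  rw [hK.eq] at h
  exact hM.add_posSemidef (h.smul hα)

theorem Xinv_X_sub_Y_formula
    {n : ℕ} (M K Λ : Matrix (Fin n) (Fin n) ℝ)
    (hM : M.PosDef) (hK : K.PosSemidef) (hΛ : Λ.PosSemidef)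
    (α β : ℝ) (hα : 0 < α) (hβ : 0 < β) :
    (Matrix.fromBlocks M (-(α • K)) K M)⁻¹ *
        (Matrix.fromBlocks M (-(α • K)) K M -
          Matrix.fromBlocks M (-(α • K) - β • Λ) K M) =
      β • Matrix.fromBlocks
        (0 : Matrix (Fin n) (Fin n) ℝ)
        ((((1 : Matrix (Fin n) (Fin n) ℝ) + α • (K * M⁻¹ * (K * M⁻¹))) * M)⁻¹ * Λ)
        (0 : Matrix (Fin n) (Fin n) ℝ)
        (-((((1 : Matrix (Fin n) (Fin n) ℝ) + α • (K * M⁻¹ * (K * M⁻¹))) * M)⁻¹ *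
            (K * M⁻¹ * Λ))) := by
  have hMu : IsUnit M.det := (Matrix.isUnit_iff_isUnit_det M).mp hM.isUnit
  have hWM : (1 + α • (K * M⁻¹ * (K * M⁻¹))) * M = M + α • (K * M⁻¹ * K) := by
    rw [add_mul, one_mul, smul_mul_assoc, ← mul_assoc (K * M⁻¹) K M⁻¹,
      Matrix.nonsing_inv_mul_cancel_right _ _ hMu]
  have hS := posDef_add_smul_mul_inv_mul hM hK.isHermitian hα.le
  rw [hWM]
  have hSM : M + α • (K * M⁻¹ * K) = M - K * M⁻¹ * -(α • K) := by
    rw [mul_neg, sub_neg_eq_add, mul_smul_comm]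
  have hSu : IsUnit (M + α • (K * M⁻¹ * K)).det :=
    (Matrix.isUnit_iff_isUnit_det _).mp hS.isUnit
  have hX : IsUnit (Matrix.fromBlocks M (-(α • K)) K M).det := by
    let _ := Matrix.invertibleOfIsUnitDet M hMu
    rw [Matrix.det_fromBlocks₁₁, Matrix.invOf_eq_nonsing_inv, ← hSM]
    exact hMu.mul hSu
  have hcomm : (M + α • (K * M⁻¹ * K)) * (M⁻¹ * K) = K * M⁻¹ * (M + α • (K * M⁻¹ * K)) := by
    rw [add_mul, mul_add, Matrix.mul_nonsing_inv_cancel_left _ _ hMu,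
      Matrix.nonsing_inv_mul_cancel_right _ _ hMu]
    simp only [smul_mul_assoc, mul_smul_comm, mul_assoc]
  generalize hSdef : M + α • (K * M⁻¹ * K) = S at *
  have hcomm' : S⁻¹ * (K * M⁻¹) = M⁻¹ * K * S⁻¹ := by
    calc S⁻¹ * (K * M⁻¹) = S⁻¹ * (K * M⁻¹ * S) * S⁻¹ := by
          rw [mul_assoc S⁻¹, Matrix.mul_nonsing_inv_cancel_right _ _ hSu]
      _ = M⁻¹ * K * S⁻¹ := by
          rw [← hcomm, Matrix.nonsing_inv_mul_cancel_left _ _ hSu]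
  have hB : S⁻¹ * (K * M⁻¹ * Λ) = M⁻¹ * (K * (S⁻¹ * Λ)) := by
    rw [← mul_assoc, hcomm']
    simp only [mul_assoc]
  have hA : M * (S⁻¹ * Λ) + α • (K * (M⁻¹ * (K * (S⁻¹ * Λ)))) = Λ := by
    calc _ = S * (S⁻¹ * Λ) := by
          nth_rewrite 3 [← hSdef]
          simp only [add_mul, smul_mul_assoc, mul_assoc]
      _ = Λ := Matrix.mul_nonsing_inv_cancel_left _ _ hSu
  have key : Matrix.fromBlocks M (-(α • K)) K M - Matrix.fromBlocks M (-(α • K) - β • Λ) K M =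
      Matrix.fromBlocks M (-(α • K)) K M *
        (β • Matrix.fromBlocks 0 (S⁻¹ * Λ) 0 (-(S⁻¹ * (K * M⁻¹ * Λ)))) := by
    rw [mul_smul_comm, Matrix.fromBlocks_multiply, Matrix.fromBlocks_smul, sub_eq_add_neg,
      Matrix.fromBlocks_neg, Matrix.fromBlocks_add, hB]
    congr 1
    · simp
    · rw [neg_mul_neg, smul_mul_assoc, hA]
      abel
    · simp
    · rw [mul_neg, Matrix.mul_nonsing_inv_cancel_left _ _ hMu]
      simp
  rw [key, Matrix.nonsing_inv_mul_cancel_left _ _ hX]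
end

section
/- Let 𝒜 = [[A, C], [B, D]] be a 2×2 block matrix over a field with A an invertible m×m block and with invertible Schur complement S = D - B A⁻¹ C (of size k×k), and let 𝒫 = [[A, C], [0, S]]. Then 𝒫 is invertible, 𝒜𝒫⁻¹ equals the block lower triangular matrix [[I_m, 0], [B A⁻¹, I_k]], and the spectrum of 𝒜𝒫⁻¹ is exactly {1}. -/
open Matrix

theorem Matrix.spectrum_fromBlocks_one_zero_one {m n F : Type*} [Fintype m] [Fintype n]
    [DecidableEq m] [DecidableEq n] [Nonempty (m ⊕ n)] [Field F] (X : Matrix n m F) :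
    spectrum F (fromBlocks 1 0 X 1 : Matrix (m ⊕ n) (m ⊕ n) F) = {1} := by
  ext r
  have hblocks : algebraMap F (Matrix (m ⊕ n) (m ⊕ n) F) r - fromBlocks 1 0 X 1 =
      fromBlocks ((r - 1) • 1) 0 (-X) ((r - 1) • 1) := by
    rw [Algebra.algebraMap_eq_smul_one, ← fromBlocks_one, fromBlocks_smul,
      sub_eq_add_neg, fromBlocks_neg, fromBlocks_add]
    simp [sub_eq_add_neg, add_smul]
  have hcard : Fintype.card m + Fintype.card n ≠ 0 := by
    rw [← Fintype.card_sum]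
    exact Fintype.card_ne_zero
  rw [spectrum.mem_iff, hblocks, isUnit_iff_isUnit_det, det_fromBlocks_zero₁₂,
    det_smul, det_smul, det_one, det_one, mul_one, mul_one,
    ← pow_add, isUnit_iff_ne_zero, not_not, pow_eq_zero_iff hcard, sub_eq_zero,
    Set.mem_singleton_iff]

theorem Matrix.fromBlocks_eq_lower_mul_schur {m n R : Type*} [Fintype m] [Fintype n]
    [DecidableEq m] [DecidableEq n] [CommRing R] (A : Matrix m m R) (C : Matrix m n R)
    (B : Matrix n m R) (D : Matrix n n R) (hA : IsUnit A) :
    fromBlocks A C B D =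
      fromBlocks 1 0 (B * A⁻¹) 1 * fromBlocks A C 0 (D - B * A⁻¹ * C) := by
  rw [isUnit_iff_isUnit_det] at hA
  simp [fromBlocks_multiply, nonsing_inv_mul_cancel_right, hA]

theorem preconditioned_spectrum_eq_one
    {m k : ℕ} (hmk : 0 < m + k) {F : Type*} [Field F]
    (A : Matrix (Fin m) (Fin m) F) (C : Matrix (Fin m) (Fin k) F)
    (B : Matrix (Fin k) (Fin m) F) (D : Matrix (Fin k) (Fin k) F)
    (hA : IsUnit A) (hS : IsUnit (D - B * A⁻¹ * C)) :
    IsUnit (Matrix.fromBlocks A C 0 (D - B * A⁻¹ * C)) ∧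
    Matrix.fromBlocks A C B D *
        (Matrix.fromBlocks A C 0 (D - B * A⁻¹ * C))⁻¹ =
      Matrix.fromBlocks 1 0 (B * A⁻¹) 1 ∧
    spectrum F (Matrix.fromBlocks A C B D *
        (Matrix.fromBlocks A C 0 (D - B * A⁻¹ * C))⁻¹) = {1} := by
  have hP : IsUnit (Matrix.fromBlocks A C 0 (D - B * A⁻¹ * C)) :=
    Matrix.isUnit_fromBlocks_zero₂₁.mpr ⟨hA, hS⟩
  have hmul : Matrix.fromBlocks A C B D * (Matrix.fromBlocks A C 0 (D - B * A⁻¹ * C))⁻¹ =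
      Matrix.fromBlocks 1 0 (B * A⁻¹) 1 := by
    rw [Matrix.fromBlocks_eq_lower_mul_schur A C B D hA]
    exact Matrix.mul_nonsing_inv_cancel_right _ _ ((Matrix.isUnit_iff_isUnit_det _).mp hP)
  have : Nonempty (Fin m ⊕ Fin k) := by
    rw [← Fintype.card_pos_iff]
    simpa using hmk
  refine ⟨hP, hmul, ?_⟩
  rw [hmul, Matrix.spectrum_fromBlocks_one_zero_one]
end
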